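/- Let f : [a,b] → ℝ be continuous with f > 0, and let g : {a,b} → ℝ. Let u_a solve the ODE u' = f on [a,b] with u(a) = g(a), and let u_b solve -u' = f on [a,b] with u(b) = g(b). Then u(x) := min{u_a(x), u_b(x)} is the unique viscosity solution of |u'| = f on (a,b) with u = g on {a,b} (assuming the compatibility condition that g does not violate the comparison principle, e.g., |g(a) - g(b)| ≤ ∫_a^b f). -/

import Mathlib

/-- `u` is a viscosity subsolution of `|u'| = f` on the set `s`. -/
def IsViscositySubsolutionEikonal (f u : ℝ → ℝ) (s : Set ℝ) : Prop :=
  ∀ x ∈ s, ∀ φ : ℝ → ℝ, ContDiff ℝ 1 φ →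
    IsLocalMax (fun y => u y - φ y) x → |deriv φ x| ≤ f x

/-- `u` is a viscosity supersolution of `|u'| = f` on the set `s`. -/
def IsViscositySupersolutionEikonal (f u : ℝ → ℝ) (s : Set ℝ) : Prop :=
  ∀ x ∈ s, ∀ φ : ℝ → ℝ, ContDiff ℝ 1 φ →
    IsLocalMin (fun y => u y - φ y) x → f x ≤ |deriv φ x|

def IsViscositySolutionEikonal (f u : ℝ → ℝ) (s : Set ℝ) : Prop :=
  IsViscositySubsolutionEikonal f u s ∧ IsViscositySupersolutionEikonal f u s

open Set Filter Topology

/-- A function continuous on `[a, b]` has there a primitive that is `C¹` on the whole line. -/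
lemma exists_contDiff_primitive {a b : ℝ} (hab : a ≤ b) {f : ℝ → ℝ}
    (hf : ContinuousOn f (Icc a b)) :
    ∃ F : ℝ → ℝ, ContDiff ℝ 1 F ∧ (∀ x ∈ Icc a b, HasDerivAt F (f x) x) ∧
      ∀ x ∈ Icc a b, ∀ y ∈ Icc a b, ∫ s in x..y, f s = F y - F x := by
  set h : ℝ → ℝ := IccExtend hab ((Icc a b).domRestrict f)
  have hc : Continuous h := (continuousOn_iff_continuous_domRestrict.1 hf).Icc_extend'
  have heq : ∀ x ∈ Icc a b, h x = f x := fun x hx => IccExtend_of_mem hab _ hx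
  have hd : ∀ x, HasDerivAt (fun y => ∫ s in a..y, h s) (h x) x := fun x =>
    intervalIntegral.integral_hasDerivAt_right (hc.intervalIntegrable _ _)
      (hc.stronglyMeasurableAtFilter _ _) hc.continuousAt
  refine ⟨fun y => ∫ s in a..y, h s, ?_, fun x hx => heq x hx ▸ hd x, fun x hx y hy => ?_⟩
  · refine contDiff_one_iff_deriv.2 ⟨fun x => (hd x).differentiableAt, ?_⟩
    rwa [funext fun x => (hd x).deriv]
  · rw [intervalIntegral.integral_interval_sub_left (hc.intervalIntegrable _ _)
      (hc.intervalIntegrable _ _)]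
    exact intervalIntegral.integral_congr fun s hs => (heq s (uIcc_subset_Icc hx hy hs)).symm

/-- A function continuous on `[p, q]` and smaller at some interior point than at both endpoints
has a local minimum in `(p, q)`. -/
lemma exists_isLocalMin_of_lt_endpoints {w : ℝ → ℝ} {p q y : ℝ} (hw : ContinuousOn w (Icc p q))
    (hy : y ∈ Ioo p q) (hp : w y < w p) (hq : w y < w q) :
    ∃ t ∈ Ioo p q, IsLocalMin w t := by
  obtain ⟨t, ht, hmin⟩ := isCompact_Icc.exists_isMinOn ⟨y, Ioo_subset_Icc_self hy⟩ hw
  have hty : w t ≤ w y := hmin (Ioo_subset_Icc_self hy)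
  have htp : p < t := lt_of_le_of_ne ht.1 (by rintro rfl; linarith)
  have htq : t < q := lt_of_le_of_ne ht.2 (by rintro rfl; linarith)
  exact ⟨t, ⟨htp, htq⟩, hmin.isLocalMin (Icc_mem_nhds htp htq)⟩

lemma exists_isLocalMax_sub_of_lt_left {w : ℝ → ℝ} {p q y : ℝ} (hw : ContinuousOn w (Icc p q))
    (hy : y ∈ Ioo p q) (h : w p < w y) :
    ∃ ψ : ℝ → ℝ, ContDiff ℝ 1 ψ ∧ ∃ t ∈ Ioo p q, 0 < deriv ψ t ∧
      IsLocalMax (fun s => w s - ψ s) t := by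
  have hpq : 0 < q - p := by linarith [hy.1, hy.2]
  set M := |w q - w p| + 1
  have hM : 0 < M := by positivity
  set r := (y - p) / (q - p)
  have hr0 : 0 ≤ r := div_nonneg (by linarith [hy.1]) hpq.le
  have hr1 : r < 1 := (div_lt_one hpq).2 (by linarith [hy.2])
  obtain ⟨n, hn⟩ := exists_pow_lt_of_lt_one (div_pos (sub_pos.2 h) hM) hr1
  have hn' : M * r ^ (n + 1) < w y - w p := by
    have : r ^ (n + 1) ≤ r ^ n := pow_le_pow_of_le_one hr0 hr1.le n.le_succ
    rw [lt_div_iff₀ hM] at hn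
    nlinarith
  set ψ : ℝ → ℝ := fun s => M * ((s - p) / (q - p)) ^ (n + 1) with hψ
  have hψc : ContDiff ℝ 1 ψ := by fun_prop
  have hψp : ψ p = 0 := by simp [hψ]
  have hψq : ψ q = M := by simp [hψ, hpq.ne']
  have hψy : ψ y < w y - w p := hn'
  obtain ⟨t, ht, hmin⟩ := exists_isLocalMin_of_lt_endpoints (w := fun s => -(w s - ψ s))
    (hw.sub hψc.continuous.continuousOn).neg hy (by linarith)
    (by linarith [le_abs_self (w q - w p)])
  refine ⟨ψ, hψc, t, ht, ?_, by simpa using hmin.neg⟩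
  have hd : HasDerivAt ψ (M * (((n + 1 : ℕ) : ℝ) * ((t - p) / (q - p)) ^ n * (1 / (q - p)))) t :=
    ((((hasDerivAt_id t).sub_const p).div_const (q - p)).pow (n + 1)).const_mul M
  rw [hd.deriv]
  have : 0 < t - p := sub_pos.2 ht.1
  positivity

lemma exists_isLocalMax_sub_of_lt_right {w : ℝ → ℝ} {p q y : ℝ} (hw : ContinuousOn w (Icc p q))
    (hy : y ∈ Ioo p q) (h : w q < w y) :
    ∃ ψ : ℝ → ℝ, ContDiff ℝ 1 ψ ∧ ∃ t ∈ Ioo p q, deriv ψ t < 0 ∧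
      IsLocalMax (fun s => w s - ψ s) t := by
  obtain ⟨ψ, hψ, t, ht, hpos, hmax⟩ := exists_isLocalMax_sub_of_lt_left
    (w := fun s => w (-s)) (p := -q) (q := -p) (y := -y)
    (hw.comp continuous_neg.continuousOn fun s hs => ⟨by linarith [hs.2], by linarith [hs.1]⟩)
    ⟨by linarith [hy.2], by linarith [hy.1]⟩ (by simpa using h)
  refine ⟨fun s => ψ (-s), hψ.comp contDiff_neg, -t, ⟨by linarith [ht.2], by linarith [ht.1]⟩,
    by simpa [deriv_comp_neg] using hpos, ?_⟩
  have hev := (continuous_neg.tendsto' (-t) t (neg_neg t)).eventually hmax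
  filter_upwards [hev] with s hs
  simpa using hs

lemma HasDerivAt.nonneg_of_eventually_right {h : ℝ → ℝ} {h' x : ℝ} (hd : HasDerivAt h h' x)
    (hev : ∀ᶠ y in 𝓝[>] x, h x ≤ h y) : 0 ≤ h' := by
  have ht := (hasDerivWithinAt_iff_tendsto_slope' self_notMem_Ioi).1
    (hd.hasDerivWithinAt (s := Ioi x))
  refine ge_of_tendsto ht ?_
  filter_upwards [hev, self_mem_nhdsWithin] with y hy hxy
  rw [slope_def_field]
  exact div_nonneg (sub_nonneg.2 hy) (sub_nonneg.2 (mem_Ioi.1 hxy).le)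

lemma HasDerivAt.nonpos_of_eventually_left {h : ℝ → ℝ} {h' x : ℝ} (hd : HasDerivAt h h' x)
    (hev : ∀ᶠ y in 𝓝[<] x, h x ≤ h y) : h' ≤ 0 := by
  have ht := (hasDerivWithinAt_iff_tendsto_slope' self_notMem_Iio).1
    (hd.hasDerivWithinAt (s := Iio x))
  refine le_of_tendsto ht ?_
  filter_upwards [hev, self_mem_nhdsWithin] with y hy hxy
  rw [slope_def_field]
  exact div_nonpos_of_nonneg_of_nonpos (sub_nonneg.2 hy) (sub_nonpos.2 (mem_Iio.1 hxy).le)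

/-- The minimum of an increasing and a decreasing branch with slopes `f` and `-f` is a viscosity
solution of `|u'| = f`. -/
lemma isViscositySolutionEikonal_min {a b : ℝ} {f F u : ℝ → ℝ} {c d : ℝ}
    (hF : ∀ x ∈ Icc a b, HasDerivAt F (f x) x) (hmono : MonotoneOn F (Icc a b))
    (hu : ∀ x ∈ Icc a b, u x = min (c + F x) (d - F x)) :
    IsViscositySolutionEikonal f u (Ioo a b) := by
  constructor <;> intro x hx φ hφ hext <;>
    have hxI := Ioo_subset_Icc_self hx <;>
    have hφd := (hφ.differentiable one_ne_zero x).hasDerivAt <;>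
    have hI := Icc_mem_nhds hx.1 hx.2
  · rw [abs_le]
    constructor
    · have := (hφd.add (hF x hxI)).nonneg_of_eventually_right (by
        filter_upwards [self_mem_nhdsWithin, nhdsWithin_le_nhds hI, nhdsWithin_le_nhds hext]
          with y hxy hy hle
        have := hmono hxI hy (mem_Ioi.1 hxy).le
        simp only [hu x hxI, hu y hy, Pi.add_apply] at hle ⊢
        rcases min_cases (c + F x) (d - F x) with h | h <;>
          rcases min_cases (c + F y) (d - F y) with h' | h' <;> linarith)
      linarith
    · have := (hφd.sub (hF x hxI)).nonpos_of_eventually_left (by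
        filter_upwards [self_mem_nhdsWithin, nhdsWithin_le_nhds hI, nhdsWithin_le_nhds hext]
          with y hxy hy hle
        have := hmono hy hxI (mem_Iio.1 hxy).le
        simp only [hu x hxI, hu y hy, Pi.sub_apply] at hle ⊢
        rcases min_cases (c + F x) (d - F x) with h | h <;>
          rcases min_cases (c + F y) (d - F y) with h' | h' <;> linarith)
      linarith
  · rcases min_choice (c + F x) (d - F x) with h | h
    · have hloc : IsLocalMax (φ - F) x := by
        filter_upwards [hI, hext] with y hy hle
        simp only [hu x hxI, hu y hy, h, Pi.sub_apply] at hle ⊢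
        linarith [min_le_left (c + F y) (d - F y)]
      have := hloc.hasDerivAt_eq_zero (hφd.sub (hF x hxI))
      rw [sub_eq_zero.1 this]
      exact le_abs_self _
    · have hloc : IsLocalMax (φ + F) x := by
        filter_upwards [hI, hext] with y hy hle
        simp only [hu x hxI, hu y hy, h, Pi.add_apply] at hle ⊢
        linarith [min_le_right (c + F y) (d - F y)]
      have := hloc.hasDerivAt_eq_zero (hφd.add (hF x hxI))
      rw [eq_neg_of_add_eq_zero_left this, abs_neg]
      exact le_abs_self _

lemma IsViscositySubsolutionEikonal.le_min {a b : ℝ} {f F v : ℝ → ℝ} (hFc : ContDiff ℝ 1 F)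
    (hF : ∀ x ∈ Icc a b, HasDerivAt F (f x) x) (hvc : ContinuousOn v (Icc a b))
    (hv : IsViscositySubsolutionEikonal f v (Ioo a b)) {x : ℝ} (hx : x ∈ Ioo a b) :
    v x ≤ min (v a + (F x - F a)) (v b + (F b - F x)) := by
  refine _root_.le_min ?_ ?_ <;> by_contra! hlt
  · obtain ⟨ψ, hψ, t, ht, hpos, hmax⟩ := exists_isLocalMax_sub_of_lt_left
      (hvc.sub hFc.continuous.continuousOn) hx (by simp only [Pi.sub_apply]; linarith)
    have hle := hv t ht (F + ψ) (hFc.add hψ) (by simpa [sub_sub] using hmax)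
    rw [((hF t (Ioo_subset_Icc_self ht)).add (hψ.differentiable one_ne_zero t).hasDerivAt).deriv]
      at hle
    linarith [(abs_le.1 hle).2]
  · obtain ⟨ψ, hψ, t, ht, hneg, hmax⟩ := exists_isLocalMax_sub_of_lt_right
      (hvc.add hFc.continuous.continuousOn) hx (by simp only [Pi.add_apply]; linarith)
    have hle := hv t ht (ψ - F) (hψ.sub hFc) (by
      convert hmax using 2 with s
      simp only [Pi.add_apply, Pi.sub_apply]
      ring)
    rw [((hψ.differentiable one_ne_zero t).hasDerivAt.sub (hF t (Ioo_subset_Icc_self ht))).deriv]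
      at hle
    linarith [(abs_le.1 hle).1]

lemma IsViscositySupersolutionEikonal.min_le {a b : ℝ} {f F v : ℝ → ℝ} (hFc : ContDiff ℝ 1 F)
    (hF : ∀ x ∈ Icc a b, HasDerivAt F (f x) x) (hfpos : ∀ x ∈ Icc a b, 0 < f x)
    (hvc : ContinuousOn v (Icc a b))
    (hv : IsViscositySupersolutionEikonal f v (Ioo a b)) {x : ℝ} (hx : x ∈ Ioo a b) :
    min (v a + (F x - F a)) (v b + (F b - F x)) ≤ v x := by
  by_contra! hlt
  obtain ⟨ha, hb⟩ := lt_min_iff.1 hlt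
  obtain ⟨ε, hε, hεlt⟩ := exists_between
    (lt_min (show 0 < v a + (F x - F a) - v x by linarith)
      (show 0 < v b + (F b - F x) - v x by linarith))
  obtain ⟨hεa, hεb⟩ := lt_min_iff.1 hεlt
  -- A smooth tent with apex at `x` and slopes smaller than `f`.
  set R : ℝ → ℝ := fun y => √(ε ^ 2 + (F y - F x) ^ 2) with hR
  have hpos : ∀ y, 0 < ε ^ 2 + (F y - F x) ^ 2 := fun y => by positivity
  have hRc : ContDiff ℝ 1 R := ContDiff.sqrt (by fun_prop) fun y => (hpos y).ne'
  have hRx : R x = ε := by simp [hR, Real.sqrt_sq hε.le]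
  have hRlt : ∀ y, |F y - F x| < R y := fun y =>
    Real.lt_sqrt_of_sq_lt (by rw [sq_abs]; nlinarith)
  obtain ⟨t, ht, hmin⟩ := exists_isLocalMin_of_lt_endpoints (w := fun y => v y - (-R) y)
    (hvc.sub hRc.neg.continuous.continuousOn) hx
    (by simp only [Pi.neg_apply]; linarith [hRlt a, neg_abs_le (F a - F x)])
    (by simp only [Pi.neg_apply]; linarith [hRlt b, le_abs_self (F b - F x)])
  have hle := hv t ht (-R) hRc.neg hmin
  have htI := Ioo_subset_Icc_self ht
  have hd : HasDerivAt R (2 * (F t - F x) * f t / (2 * R t)) t := by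
    refine ((((hF t htI).sub_const (F x)).pow 2).const_add (ε ^ 2)).sqrt (hpos t).ne'
      |>.congr_deriv ?_
    simp [hR]
  have hRt : 0 < R t := Real.sqrt_pos.2 (hpos t)
  have hft := hfpos t htI
  rw [hd.neg.deriv, abs_neg, mul_assoc, mul_div_mul_left _ _ two_ne_zero, abs_div, abs_mul,
    abs_of_pos hft, abs_of_pos hRt, le_div_iff₀ hRt] at hle
  nlinarith [hRlt t]

theorem eikonal_1d_min_of_branches (a b : ℝ) (hab : a < b) (f g : ℝ → ℝ)
    (hf : ContinuousOn f (Set.Icc a b)) (hfpos : ∀ x ∈ Set.Icc a b, 0 < f x)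
    (hcompat : |g a - g b| ≤ ∫ s in a..b, f s)
    (ua ub u : ℝ → ℝ)
    (hua : ∀ x, ua x = g a + ∫ s in a..x, f s)
    (hub : ∀ x, ub x = g b + ∫ s in x..b, f s)
    (hu : ∀ x, u x = min (ua x) (ub x)) :
    (IsViscositySolutionEikonal f u (Set.Ioo a b) ∧ u a = g a ∧ u b = g b) ∧
    (∀ v : ℝ → ℝ, ContinuousOn v (Set.Icc a b) →
      IsViscositySolutionEikonal f v (Set.Ioo a b) → v a = g a → v b = g b →
      ∀ x ∈ Set.Icc a b, v x = u x) := by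
  obtain ⟨F, hFc, hF, hint⟩ := exists_contDiff_primitive hab.le hf
  have haI : a ∈ Icc a b := left_mem_Icc.2 hab.le
  have hbI : b ∈ Icc a b := right_mem_Icc.2 hab.le
  have hueq : ∀ x ∈ Icc a b, u x = min (g a + (F x - F a)) (g b + (F b - F x)) :=
    fun x hx => by rw [hu, hua, hub, hint a haI x hx, hint x hx b hbI]
  rw [hint a haI b hbI, abs_le] at hcompat
  have hua' : u a = g a := by
    rw [hueq a haI, min_eq_left (by linarith), sub_self, add_zero]
  have hub' : u b = g b := by
    rw [hueq b hbI, min_eq_right (by linarith), sub_self, add_zero]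
  have hmono : MonotoneOn F (Icc a b) :=
    monotoneOn_of_deriv_nonneg (convex_Icc a b) hFc.continuous.continuousOn
      (hFc.differentiable one_ne_zero).differentiableOn fun x hx => by
        rw [(hF x (interior_subset hx)).deriv]
        exact (hfpos x (interior_subset hx)).le
  refine ⟨⟨?_, hua', hub'⟩, fun v hvc hv hva hvb x hx => ?_⟩
  · refine isViscositySolutionEikonal_min (c := g a - F a) (d := g b + F b) hF hmono
      fun x hx => ?_
    rw [hueq x hx]
    congr 1 <;> ring
  · rcases eq_endpoints_or_mem_Ioo_of_mem_Icc hx with rfl | rfl | hx'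
    · rw [hva, hua']
    · rw [hvb, hub']
    · rw [hueq x hx, ← hva, ← hvb]
      exact le_antisymm (hv.1.le_min hFc hF hvc hx') (hv.2.min_le hFc hF hfpos hvc hx')
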